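/- Suppose (γ,ℓ⁺,ℓ⁻) : I → ℝ³₁ × Δ₄ is a lightcone framed curve with lightcone curvature (κ₁,κ₂,κ₃,α,β) and there exist smooth functions λ, k : I → ℝ with λ ≢ 0 and k(t)α(t) = λ(t)κ₂(t) for all t ∈ I. Then (γ̄,ℓ̄⁺,ℓ̄⁻) defined by γ̄(t) = γ(t) + λ(t)ℓ⁻(t), ℓ̄⁺(t) = ℓ⁻(t), ℓ̄⁻(t) = ℓ⁺(t) + k²(t)ℓ⁻(t) + 2k(t)n(t) is a lightcone framed curve whose lightcone curvature (κ̄₁,κ̄₂,κ̄₃,ᾱ,β̄) is given by κ̄₁ = −κ₁ − 2kκ₂, κ̄₂ = −k' + kκ₁ + k²κ₂ − κ₃, κ̄₃ = −κ₂, ᾱ = β + λ' − λκ₁ − k²α, β̄ = α. -/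

import Mathlib

open Matrix

noncomputable section

/-- The Minkowski pseudo-scalar product on `ℝ³`:
`⟨x,y⟩ = −x₁y₁ + x₂y₂ + x₃y₃`. -/
def mdot (x y : Fin 3 → ℝ) : ℝ := -(x 0 * y 0) + x 1 * y 1 + x 2 * y 2

/-- The pseudo vector product `x ∧ y` on Minkowski `ℝ³`, i.e. the determinant of the
matrix with rows `(−e₁, e₂, e₃)`, `x`, `y`. -/
def mcross (x y : Fin 3 → ℝ) : Fin 3 → ℝ :=
  ![-(x 1 * y 2 - x 2 * y 1), x 2 * y 0 - x 0 * y 2, x 0 * y 1 - x 1 * y 0]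

/-- The (punctured) lightcone `LC* = {x ≠ 0 : ⟨x,x⟩ = 0}`. -/
def LCstar (x : Fin 3 → ℝ) : Prop := x ≠ 0 ∧ mdot x x = 0

/-- Membership in `Δ₄ = {(v,w) ∈ LC* × LC* : ⟨v,w⟩ = −2}`. -/
def MemDelta4 (v w : Fin 3 → ℝ) : Prop := LCstar v ∧ LCstar w ∧ mdot v w = -2

/-- `n(t) = −(1/2) ℓ⁺(t) ∧ ℓ⁻(t)`. -/
def lcn (lp lm : ℝ → Fin 3 → ℝ) : ℝ → Fin 3 → ℝ :=
  fun t => (-(1/2) : ℝ) • mcross (lp t) (lm t)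

/-- Smoothness (on `I`) of a real valued function. -/
def Smooth1 (I : Set ℝ) (f : ℝ → ℝ) : Prop := ContDiffOn ℝ (⊤ : ℕ∞) f I

/-- Smoothness (on `I`) of an `ℝ³`-valued function. -/
def Smooth3 (I : Set ℝ) (f : ℝ → Fin 3 → ℝ) : Prop := ContDiffOn ℝ (⊤ : ℕ∞) f I

/-- `λ ≢ 0` : the set where `λ` is non-zero is dense in `I`. -/
def NotIdentZero (I : Set ℝ) (f : ℝ → ℝ) : Prop :=
  I ⊆ closure {t | t ∈ I ∧ f t ≠ 0}

/-- A lightcone framed curve `(γ, ℓ⁺, ℓ⁻) : I → ℝ³₁ × Δ₄`. -/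
structure IsLightconeFramedCurve (I : Set ℝ) (γ lp lm : ℝ → Fin 3 → ℝ) : Prop where
  smooth_base : Smooth3 I γ
  smooth_lp : Smooth3 I lp
  smooth_lm : Smooth3 I lm
  delta4 : ∀ t ∈ I, MemDelta4 (lp t) (lm t)
  exists_coeffs : ∃ α β : ℝ → ℝ, Smooth1 I α ∧ Smooth1 I β ∧
    ∀ t ∈ I, deriv γ t = α t • lp t + β t • lm t

/-- `(κ₁, κ₂, κ₃, α, β)` is the lightcone curvature of the lightcone framed curve
`(γ, ℓ⁺, ℓ⁻)`. -/
structure HasLightconeCurvature (I : Set ℝ) (γ lp lm : ℝ → Fin 3 → ℝ)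
    (κ₁ κ₂ κ₃ α β : ℝ → ℝ) : Prop where
  smooth_κ₁ : Smooth1 I κ₁
  smooth_κ₂ : Smooth1 I κ₂
  smooth_κ₃ : Smooth1 I κ₃
  smooth_α : Smooth1 I α
  smooth_β : Smooth1 I β
  deriv_lp : ∀ t ∈ I, deriv lp t = κ₁ t • lp t + (2 * κ₃ t) • lcn lp lm t
  deriv_lm : ∀ t ∈ I, deriv lm t = (-κ₁ t) • lm t + (2 * κ₂ t) • lcn lp lm t
  deriv_n : ∀ t ∈ I, deriv (lcn lp lm) t = κ₂ t • lp t + κ₃ t • lm t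
  deriv_base : ∀ t ∈ I, deriv γ t = α t • lp t + β t • lm t

/-- The vector field `ℓ⁺` built from a lightcone frame. -/
def fieldLp (lp lm : ℝ → Fin 3 → ℝ) : ℝ → Fin 3 → ℝ := fun t => lp t
/-- The vector field `ℓ⁻` built from a lightcone frame. -/
def fieldLm (lp lm : ℝ → Fin 3 → ℝ) : ℝ → Fin 3 → ℝ := fun t => lm t
/-- `nᵀ = (ℓ⁺ + ℓ⁻)/2`. -/
def fieldNT (lp lm : ℝ → Fin 3 → ℝ) : ℝ → Fin 3 → ℝ := fun t => (1/2 : ℝ) • (lp t + lm t)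
/-- `nˢ = (ℓ⁺ − ℓ⁻)/2`. -/
def fieldNS (lp lm : ℝ → Fin 3 → ℝ) : ℝ → Fin 3 → ℝ := fun t => (1/2 : ℝ) • (lp t - lm t)
/-- `n = −(1/2) ℓ⁺ ∧ ℓ⁻`. -/
def fieldN (lp lm : ℝ → Fin 3 → ℝ) : ℝ → Fin 3 → ℝ := lcn lp lm
/-- `ℓ̃⁺ = nᵀ + n`. -/
def fieldLtp (lp lm : ℝ → Fin 3 → ℝ) : ℝ → Fin 3 → ℝ :=
  fun t => fieldNT lp lm t + fieldN lp lm t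
/-- `ℓ̃⁻ = nᵀ − n`. -/
def fieldLtm (lp lm : ℝ → Fin 3 → ℝ) : ℝ → Fin 3 → ℝ :=
  fun t => fieldNT lp lm t - fieldN lp lm t

/-- `(γ,ℓ⁺,ℓ⁻)` and `(γ̄,ℓ̄⁺,ℓ̄⁻)` are `(v,w̄)`-mates. -/
def AreMates (I : Set ℝ)
    (v w : (ℝ → Fin 3 → ℝ) → (ℝ → Fin 3 → ℝ) → ℝ → Fin 3 → ℝ)
    (γ lp lm γ' lp' lm' : ℝ → Fin 3 → ℝ) : Prop :=
  IsLightconeFramedCurve I γ lp lm ∧ IsLightconeFramedCurve I γ' lp' lm' ∧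
  ∃ lam : ℝ → ℝ, Smooth1 I lam ∧ NotIdentZero I lam ∧
    (∀ t ∈ I, γ' t = γ t + lam t • v lp lm t) ∧
    (∀ t ∈ I, v lp lm t = w lp' lm' t)

/-- `(γ,ℓ⁺,ℓ⁻)` is a `(v,w̄)`-Bertrand lightcone framed curve. -/
def IsBertrand (I : Set ℝ)
    (v w : (ℝ → Fin 3 → ℝ) → (ℝ → Fin 3 → ℝ) → ℝ → Fin 3 → ℝ)
    (γ lp lm : ℝ → Fin 3 → ℝ) : Prop :=
  ∃ γ' lp' lm' : ℝ → Fin 3 → ℝ, AreMates I v w γ lp lm γ' lp' lm'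

/-- Smoothness of the normal field of a smooth lightcone frame. -/
theorem Smooth3.lcn {I : Set ℝ} {lp lm : ℝ → Fin 3 → ℝ} (hp : Smooth3 I lp)
    (hm : Smooth3 I lm) : Smooth3 I (lcn lp lm) := by
  have p (i : Fin 3) : ContDiffOn ℝ (⊤ : ℕ∞) (fun t => lp t i) I := contDiffOn_pi.1 hp i
  have m (i : Fin 3) : ContDiffOn ℝ (⊤ : ℕ∞) (fun t => lm t i) I := contDiffOn_pi.1 hm i
  refine ContDiffOn.const_smul _ (contDiffOn_pi.2 fun i => ?_)
  fin_cases i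
  · exact (((p 1).mul (m 2)).sub ((p 2).mul (m 1))).neg
  · exact ((p 2).mul (m 0)).sub ((p 0).mul (m 2))
  · exact ((p 0).mul (m 1)).sub ((p 1).mul (m 0))

/-- The normal of the frame `(w, v + k² w + 2k n)`, where `n` is the normal of `(v, w)`,
is `-n - k w`. -/
theorem MemDelta4.mcross_mate {v w : Fin 3 → ℝ} (h : MemDelta4 v w) (k : ℝ) :
    (-(1/2) : ℝ) • mcross w (v + k ^ 2 • w + (2 * k) • (-(1/2) : ℝ) • mcross v w) =
      -((-(1/2) : ℝ) • mcross v w) - k • w := by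
  obtain ⟨-, ⟨-, hww⟩, hvw⟩ := h
  simp only [mdot] at hww hvw
  ext i
  fin_cases i <;> simp [mcross]
  · linear_combination (k / 2 * w 0) * hvw - (k / 2 * v 0) * hww
  · linear_combination (k / 2 * w 1) * hvw - (k / 2 * v 1) * hww
  · linear_combination (k / 2 * w 2) * hvw - (k / 2 * v 2) * hww

/-- If `(v, w) ∈ Δ₄` has normal `n`, then `(w, v + k² w + 2k n) ∈ Δ₄`. -/
theorem MemDelta4.mate {v w : Fin 3 → ℝ} (h : MemDelta4 v w) (k : ℝ) :
    MemDelta4 w (v + k ^ 2 • w + (2 * k) • (-(1/2) : ℝ) • mcross v w) := by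
  obtain ⟨⟨-, hvv⟩, hw, hvw⟩ := h
  have hww := hw.2
  have hpair : mdot w (v + k ^ 2 • w + (2 * k) • (-(1/2) : ℝ) • mcross v w) = -2 := by
    simp only [mdot] at hww hvw
    simp [mdot, mcross]
    linear_combination hvw + k ^ 2 * hww
  refine ⟨hw, ⟨fun h0 => ?_, ?_⟩, hpair⟩
  · rw [h0] at hpair
    simp [mdot] at hpair
  · have hnn : mdot (mcross v w) (mcross v w) = mdot v w ^ 2 - mdot v v * mdot w w := by
      simp [mdot, mcross]
      ring
    have hexp : mdot (v + k ^ 2 • w + (2 * k) • (-(1/2) : ℝ) • mcross v w)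
        (v + k ^ 2 • w + (2 * k) • (-(1/2) : ℝ) • mcross v w) =
        mdot v v + k ^ 4 * mdot w w + 2 * k ^ 2 * mdot v w +
          k ^ 2 * mdot (mcross v w) (mcross v w) := by
      simp [mdot, mcross]
      ring
    rw [hexp, hnn, hvv, hww, hvw]
    ring

/-- Curvature of the `(ℓ⁻,ℓ̄⁺)`-mate. -/
theorem curvature_lm_lpbar_mate
    (I : Set ℝ) (hIo : IsOpen I) (hIc : I.OrdConnected)
    (γ lp lm : ℝ → Fin 3 → ℝ) (κ₁ κ₂ κ₃ α β : ℝ → ℝ)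
    (hF : IsLightconeFramedCurve I γ lp lm)
    (hC : HasLightconeCurvature I γ lp lm κ₁ κ₂ κ₃ α β)
    (lam k : ℝ → ℝ) (hlam : Smooth1 I lam) (hk : Smooth1 I k)
    (hne : NotIdentZero I lam)
    (hrel : ∀ t ∈ I, k t * α t = lam t * κ₂ t) :
    IsLightconeFramedCurve I (fun t => γ t + lam t • lm t) lm
      (fun t => lp t + (k t) ^ 2 • lm t + (2 * k t) • lcn lp lm t) ∧
    HasLightconeCurvature I (fun t => γ t + lam t • lm t) lm
      (fun t => lp t + (k t) ^ 2 • lm t + (2 * k t) • lcn lp lm t)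
      (fun t => -κ₁ t - 2 * k t * κ₂ t)
      (fun t => -deriv k t + k t * κ₁ t + (k t) ^ 2 * κ₂ t - κ₃ t)
      (fun t => -κ₂ t)
      (fun t => β t + deriv lam t - lam t * κ₁ t - (k t) ^ 2 * α t)
      α := by
  have hD : ∀ t ∈ I, MemDelta4 (lp t) (lm t) := hF.delta4
  have hn : Smooth3 I (lcn lp lm) := hF.smooth_lp.lcn hF.smooth_lm
  have hdiff3 {f : ℝ → Fin 3 → ℝ} (hf : Smooth3 I f) {t : ℝ} (ht : t ∈ I) :
      HasDerivAt f (deriv f t) t :=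
    ((hf.contDiffAt (hIo.mem_nhds ht)).differentiableAt (by simp)).hasDerivAt
  have hdiff1 {f : ℝ → ℝ} (hf : Smooth1 I f) {t : ℝ} (ht : t ∈ I) :
      HasDerivAt f (deriv f t) t :=
    ((hf.contDiffAt (hIo.mem_nhds ht)).differentiableAt (by simp)).hasDerivAt
  have hn_mate : ∀ t ∈ I,
      lcn lm (fun t => lp t + (k t) ^ 2 • lm t + (2 * k t) • lcn lp lm t) t =
        -lcn lp lm t - k t • lm t := fun t ht => (hD t ht).mcross_mate (k t)
  have hk' : Smooth1 I (deriv k) := hk.deriv_of_isOpen hIo (by simp)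
  have hlam' : Smooth1 I (deriv lam) := hlam.deriv_of_isOpen hIo (by simp)
  have hbase : ∀ t ∈ I, deriv (fun t => γ t + lam t • lm t) t =
      (β t + deriv lam t - lam t * κ₁ t - (k t) ^ 2 * α t) • lm t +
        α t • (lp t + (k t) ^ 2 • lm t + (2 * k t) • lcn lp lm t) := by
    intro t ht
    rw [((hdiff3 hF.smooth_base ht).fun_add
      ((hdiff1 hlam ht).fun_smul (hdiff3 hF.smooth_lm ht))).deriv,
      hC.deriv_base t ht, hC.deriv_lm t ht]
    ext i
    simp only [Pi.add_apply, Pi.smul_apply, smul_eq_mul]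
    linear_combination (-2 * lcn lp lm t i) * hrel t ht
  have hα_mate : Smooth1 I
      (fun t => β t + deriv lam t - lam t * κ₁ t - (k t) ^ 2 * α t) :=
    ((hC.smooth_β.add hlam').sub (hlam.mul hC.smooth_κ₁)).sub ((hk.pow 2).mul hC.smooth_α)
  refine ⟨⟨hF.smooth_base.add (hlam.smul hF.smooth_lm), hF.smooth_lm,
    (hF.smooth_lp.add ((hk.pow 2).smul hF.smooth_lm)).add
      ((contDiffOn_const.mul hk).smul hn),
    fun t ht => (hD t ht).mate (k t), _, α, hα_mate, hC.smooth_α, hbase⟩,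
    hC.smooth_κ₁.neg.sub ((contDiffOn_const.mul hk).mul hC.smooth_κ₂),
    ((hk'.neg.add (hk.mul hC.smooth_κ₁)).add ((hk.pow 2).mul hC.smooth_κ₂)).sub hC.smooth_κ₃,
    hC.smooth_κ₂.neg, hα_mate, hC.smooth_α, fun t ht => ?_, fun t ht => ?_, fun t ht => ?_, hbase⟩
  · rw [hn_mate t ht, hC.deriv_lm t ht]
    module
  · rw [hn_mate t ht, (((hdiff3 hF.smooth_lp ht).fun_add
      (((hdiff1 hk ht).fun_pow 2).fun_smul (hdiff3 hF.smooth_lm ht))).fun_add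
      (((hdiff1 hk ht).const_mul 2).fun_smul (hdiff3 hn ht))).deriv,
      hC.deriv_lp t ht, hC.deriv_lm t ht, hC.deriv_n t ht]
    ext i
    simp only [Pi.add_apply, Pi.sub_apply, Pi.neg_apply, Pi.smul_apply, smul_eq_mul]
    push_cast
    ring
  · rw [((Set.EqOn.eventuallyEq_of_mem hn_mate (hIo.mem_nhds ht)).deriv_eq :),
      ((hdiff3 hn ht).fun_neg.fun_sub
        ((hdiff1 hk ht).fun_smul (hdiff3 hF.smooth_lm ht))).deriv,
      hC.deriv_lm t ht, hC.deriv_n t ht]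
    module
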